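/- Let R be a countable Borel equivalence relation on X, c : R → Γ a cocycle into a countable group Γ (c(x,z) = c(x,y)c(y,z)), and suppose Ker(c) is ergodic with respect to an R-quasi-invariant probability measure μ. Define Γ_x = {c(x,y) : y ∈ [x]_R}. Then there is a subgroup Λ ≤ Γ such that Γ_x = Λ for μ-almost every x ∈ X. -/

import Mathlib

open MeasureTheory

/-- `S` is an ergodic (sub)equivalence relation w.r.t. `μ`: every measurable
`S`-saturated set is null or conull. -/
def IsErgodicRel {X : Type} [MeasurableSpace X] (μ : Measure X)
    (S : Set (X × X)) : Prop :=
  ∀ A : Set X, MeasurableSet A → (∀ x ∈ A, ∀ y, (x, y) ∈ S → y ∈ A) →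
    μ A = 0 ∨ μ A = 1

/-- `μ` is `R`-quasi-invariant: every measure-preserving-free Borel automorphism
of `X` with graph in `R` preserves the class of null sets. -/
def IsQuasiInvariant {X : Type} [MeasurableSpace X] (μ : Measure X)
    (R : Set (X × X)) : Prop :=
  ∀ f : X ≃ᵐ X, (∀ x, (x, f x) ∈ R) →
    ∀ A : Set X, MeasurableSet A → (μ A = 0 ↔ μ (f ⁻¹' A) = 0)


open Set Filter Topology ENNReal in
theorem ERS_capacity {X : Type*} [TopologicalSpace X] [PolishSpace X] [MeasurableSpace X]
    [BorelSpace X] (μ : Measure X) [IsFiniteMeasure μ] (f : (ℕ → ℕ) → X) (hf : Continuous f)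
    (t : ℝ≥0∞) (ht : t < μ (range f)) : ∃ K : Set (ℕ → ℕ), IsCompact K ∧ t ≤ μ (f '' K) := by
  let := TopologicalSpace.upgradeIsCompletelyMetrizable X
  have step : ∀ (S : Set (ℕ → ℕ)) (n : ℕ), ∃ k : ℕ, t < μ (f '' S) →
      t < μ (f '' (S ∩ {a | a n ≤ k})) := by
    intro S n
    by_cases h : t < μ (f '' S)
    · have hU : f '' S = ⋃ k : ℕ, f '' (S ∩ {a | a n ≤ k}) := by
        rw [← image_iUnion, ← inter_iUnion]
        congr 1
        ext a
        simp only [mem_inter_iff, mem_iUnion, mem_ofPred_eq]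
        exact ⟨fun h => ⟨h, _, le_rfl⟩, fun h => h.1⟩
      have hm : Monotone (fun k : ℕ => f '' (S ∩ {a | a n ≤ k})) := by
        intro k l hkl
        apply image_mono
        apply inter_subset_inter_right
        intro a (ha : a n ≤ k)
        exact le_trans ha hkl
      have h' := h
      rw [hU, hm.measure_iUnion] at h'
      obtain ⟨k, hk⟩ := lt_iSup_iff.1 h'
      exact ⟨k, fun _ => hk⟩
    · exact ⟨0, fun h' => absurd h' h⟩
  choose k hk using step
  let C : ℕ → Set (ℕ → ℕ) := fun n => Nat.rec univ (fun n S => S ∩ {a | a n ≤ k S n}) n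
  have hC0 : C 0 = univ := rfl
  have hCs : ∀ n, C (n + 1) = C n ∩ {a | a n ≤ k (C n) n} := fun n => rfl
  let b : ℕ → ℕ := fun n => k (C n) n
  have hCt : ∀ n, t < μ (f '' C n) := by
    intro n
    induction n with
    | zero => rw [hC0, image_univ]; exact ht
    | succ n ih => rw [hCs]; exact hk _ _ ih
  have hCb : ∀ n a, a ∈ C n → ∀ i < n, a i ≤ b i := by
    intro n
    induction n with
    | zero => intro a _ i hi; omega
    | succ n ih =>
      intro a ha i hi
      rw [hCs] at ha
      rcases Nat.lt_succ_iff_lt_or_eq.1 hi with h | rfl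
      · exact ih a ha.1 i h
      · exact ha.2
  have hCanti : Antitone C := antitone_nat_of_succ_le (fun n => by rw [hCs]; exact inter_subset_left)
  let K : Set (ℕ → ℕ) := pi univ (fun i => Iic (b i))
  have hK : IsCompact K := isCompact_univ_pi (fun i => (finite_Iic (b i)).isCompact)
  refine ⟨K, hK, ?_⟩
  have hsub : (⋂ n, closure (f '' C n)) ⊆ f '' K := by
    intro x hx
    have h1 : ∀ n : ℕ, ∃ a ∈ C n, dist x (f a) < 1 / ((n : ℝ) + 1) := by
      intro n
      obtain ⟨y, ⟨a, ha, rfl⟩, hy⟩ := Metric.mem_closure_iff.1 (mem_iInter.1 hx n)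
        (1 / ((n : ℝ) + 1)) Nat.one_div_pos_of_nat
      exact ⟨a, ha, hy⟩
    choose a haC had using h1
    obtain ⟨z, hz, φ, hφ, hlim⟩ := hK.tendsto_subseq (x := fun n i => min (a n i) (b i))
      (fun n i _ => mem_Iic.2 (min_le_right _ _))
    refine ⟨z, hz, ?_⟩
    have hlim2 : Tendsto (a ∘ φ) atTop (𝓝 z) := by
      rw [tendsto_pi_nhds] at hlim ⊢
      intro i
      refine (hlim i).congr' ?_
      filter_upwards [eventually_gt_atTop i] with n hn
      have : a (φ n) i ≤ b i := hCb _ _ (haC (φ n)) i (lt_of_lt_of_le hn (hφ.id_le n))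
      simp [this]
    have hl3 : Tendsto (fun n => f (a (φ n))) atTop (𝓝 (f z)) := (hf.tendsto z).comp hlim2
    have hl4 : Tendsto (fun n => f (a n)) atTop (𝓝 x) := by
      rw [tendsto_iff_dist_tendsto_zero]
      refine squeeze_zero (fun _ => dist_nonneg) (fun n => ?_)
        (tendsto_one_div_add_atTop_nhds_zero_nat (𝕜 := ℝ))
      rw [dist_comm]; exact (had n).le
    exact tendsto_nhds_unique hl3 (hl4.comp hφ.tendsto_atTop)
  refine le_trans ?_ (measure_mono hsub)
  have hT := tendsto_measure_iInter_atTop (μ := μ) (s := fun n => closure (f '' C n))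
    (fun n => isClosed_closure.measurableSet.nullMeasurableSet)
    (fun m n h => closure_mono (image_mono (hCanti h))) ⟨0, measure_ne_top _ _⟩
  exact ge_of_tendsto' hT (fun n => (hCt n).le.trans (measure_mono subset_closure))

open Set Filter Topology ENNReal in
theorem ERS_nullMeasurable {X : Type*} [TopologicalSpace X] [PolishSpace X] [MeasurableSpace X]
    [BorelSpace X] (μ : Measure X) [IsFiniteMeasure μ] (A : Set X) (hA : AnalyticSet A) :
    ∃ B, MeasurableSet B ∧ B ⊆ A ∧ μ (A \ B) = 0 := by
  rw [AnalyticSet] at hA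
  rcases hA with rfl | ⟨f, hf, rfl⟩
  · exact ⟨∅, MeasurableSet.empty, subset_rfl, by simp⟩
  by_cases h0 : μ (range f) = 0
  · exact ⟨∅, MeasurableSet.empty, empty_subset _, by simpa using h0⟩
  obtain ⟨u, -, hu, hul⟩ := exists_seq_strictMono_tendsto' (pos_iff_ne_zero.2 h0)
  choose K hK hKu using fun n => ERS_capacity μ f hf (u n) (hu n).2
  have hm : MeasurableSet (⋃ n, f '' K n) :=
    MeasurableSet.iUnion fun n => ((hK n).image hf).measurableSet
  have hs : (⋃ n, f '' K n) ⊆ range f := iUnion_subset fun n => image_subset_range _ _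
  refine ⟨_, hm, hs, ?_⟩
  rw [measure_sdiff hs hm.nullMeasurableSet (measure_ne_top _ _), tsub_eq_zero_iff_le]
  exact le_of_tendsto' hul fun n =>
    (hKu n).trans (measure_mono (subset_iUnion (fun n => f '' K n) n))

open Set Filter Topology ENNReal in
theorem ERS_exists_theta : ∃ θ : (ℕ → ℕ) → ℝ, Continuous θ ∧ Function.Injective θ := by
  let e : (ℕ × ℕ → Bool) ≃ₜ (ℕ → Bool) := Homeomorph.piCongrLeft (Y := fun _ => Bool) Nat.pairEquiv
  let j : (ℕ → ℕ) → (ℕ × ℕ → Bool) := fun a p => decide (a p.1 = p.2)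
  have hj : Continuous j := by
    refine continuous_pi fun p => ?_
    exact (continuous_of_discreteTopology (f := fun m : ℕ => decide (m = p.2))).comp
      (continuous_apply p.1)
  have hji : Function.Injective j := by
    intro a b h
    funext n
    have := congrFun h (n, b n)
    simpa [j] using this
  refine ⟨fun a => (cantorSetHomeomorphNatToBool.symm (e (j a)) : ℝ), ?_, ?_⟩
  · exact continuous_subtype_val.comp
      ((cantorSetHomeomorphNatToBool.symm.continuous.comp e.continuous).comp hj)
  · exact Subtype.val_injective.comp
      ((cantorSetHomeomorphNatToBool.symm.injective.comp e.injective).comp hji)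

open Set Filter Topology ENNReal in
theorem ERS_section {X : Type*} [TopologicalSpace X] [PolishSpace X] [MeasurableSpace X]
    [BorelSpace X] (μ : Measure X) [IsFiniteMeasure μ] (f : (ℕ → ℕ) → X) (hf : Continuous f)
    (h0 : μ (range f) ≠ 0) : ∃ (B : Set X) (s : X → (ℕ → ℕ)), MeasurableSet B ∧ μ B ≠ 0 ∧
      Measurable s ∧ ∀ x ∈ B, f (s x) = x := by
  classical
  obtain ⟨u, hu0, hu⟩ := exists_between (pos_iff_ne_zero.2 h0)
  obtain ⟨K, hK, hKu⟩ := ERS_capacity μ f hf u hu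
  obtain ⟨θ, hθ, hθi⟩ := ERS_exists_theta
  have hθe : MeasurableEmbedding θ := hθ.measurableEmbedding hθi
  have hBm : MeasurableSet (f '' K) := (hK.image hf).measurableSet
  have hmin : ∀ x : X, ∃ a : ℕ → ℕ, x ∈ f '' K →
      (a ∈ K ∧ f a = x ∧ ∀ b ∈ K, f b = x → θ a ≤ θ b) := by
    intro x
    by_cases hx : x ∈ f '' K
    · have hc : IsCompact (K ∩ f ⁻¹' {x}) := hK.inter_right (isClosed_singleton.preimage hf)
      have hne : (K ∩ f ⁻¹' {x}).Nonempty := by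
        obtain ⟨a, ha, hax⟩ := hx; exact ⟨a, ha, hax⟩
      obtain ⟨a, ha, hamin⟩ := hc.exists_isMinOn hne hθ.continuousOn
      exact ⟨a, fun _ => ⟨ha.1, ha.2, fun b hb hbx => hamin ⟨hb, hbx⟩⟩⟩
    · exact ⟨0, fun h => absurd h hx⟩
  choose σ hσ using hmin
  let s : X → (ℕ → ℕ) := fun x => if x ∈ f '' K then σ x else 0
  refine ⟨f '' K, s, hBm, (hu0.trans_le hKu).ne', ?_, ?_⟩
  · rw [← hθe.measurable_comp_iff]
    have : θ ∘ s = (f '' K).piecewise (fun x => θ (σ x)) (fun _ => θ 0) := by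
      funext x
      by_cases hx : x ∈ f '' K <;> simp only [s, Function.comp, hx, Set.piecewise, if_true, if_false]
    rw [this]
    refine measurable_of_Iic fun r => ?_
    rw [piecewise_preimage]
    have h1 : (f '' K) ∩ (fun x => θ (σ x)) ⁻¹' Iic r = f '' (K ∩ θ ⁻¹' Iic r) := by
      ext x
      constructor
      · rintro ⟨hx, hr⟩
        exact ⟨σ x, ⟨(hσ x hx).1, hr⟩, (hσ x hx).2.1⟩
      · rintro ⟨a, ⟨ha, hr⟩, rfl⟩
        exact ⟨⟨a, ha, rfl⟩, ((hσ _ ⟨a, ha, rfl⟩).2.2 a ha rfl).trans hr⟩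
    rw [Set.ite, inter_comm, h1]
    refine MeasurableSet.union ?_ ?_
    · exact ((hK.inter_right (isClosed_Iic.preimage hθ)).image hf).measurableSet
    · exact (measurable_const measurableSet_Iic).diff hBm
  · intro x hx
    simp only [s, hx, if_true]
    exact (hσ x hx).2.1

open Set Filter Topology ENNReal in
theorem ERS_injOn {X Y : Type*} [TopologicalSpace X] [PolishSpace X] [MeasurableSpace X]
    [BorelSpace X] [MeasurableSpace Y] [StandardBorelSpace Y] (μ : Measure X) [IsFiniteMeasure μ]
    (B : Set X) (hB : MeasurableSet B) (h0 : μ B ≠ 0) (s : X → Y) (hs : Measurable s)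
    (hc : ∀ y, (B ∩ s ⁻¹' {y}).Countable) :
    ∃ F ⊆ B, MeasurableSet F ∧ μ F ≠ 0 ∧ InjOn s F := by
  have hne : Nonempty X := by
    by_contra h
    rw [not_nonempty_iff] at h
    exact h0 (by rw [Set.eq_empty_of_isEmpty B]; simp)
  let ν : Measure X := μ.restrict B
  let ρ : Measure (Y × X) := ν.map (fun x => (s x, x))
  have hsx : Measurable (fun x => (s x, x)) := hs.prodMk measurable_id
  let κ := ρ.condKernel
  have hdis : ρ.fst.compProd κ = ρ := ρ.disintegrate κ
  have hmeas : Measurable (fun p : Y × X => κ p.1 {p.2}) := by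
    have := ProbabilityTheory.Kernel.measurable_kernel_prodMk_left
      (κ := κ.comap (Prod.fst : Y × X → Y) measurable_fst)
      (t := {q : (Y × X) × X | q.2 = q.1.2})
      (measurableSet_eq_fun measurable_snd (measurable_snd.comp measurable_fst))
    let η : ProbabilityTheory.Kernel (Y × X) X := κ.comap Prod.fst measurable_fst
    have he : (fun p : Y × X => κ p.1 {p.2}) = fun p => η p (Prod.mk p ⁻¹' {q : (Y × X) × X | q.2 = q.1.2}) := by
      funext p
      change κ p.1 {p.2} = κ p.1 _
      congr 1
    rw [he]
    exact this
  have hnull : ν {x | κ (s x) {x} = 0} = 0 := by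
    let E : Set (Y × X) := {p | κ p.1 {p.2} = 0} ∩ ({p | s p.2 = p.1} ∩ Prod.snd ⁻¹' B)
    have hE : MeasurableSet E := by
      refine (hmeas (measurableSet_singleton 0)).inter (MeasurableSet.inter ?_ (measurable_snd hB))
      exact measurableSet_eq_fun (hs.comp measurable_snd) measurable_fst
    have hρE : ρ E = 0 := by
      rw [← hdis, Measure.compProd_apply hE]
      refine lintegral_eq_zero_of_ae_eq_zero (ae_of_all _ fun y => ?_)
      have hcy : (Prod.mk y ⁻¹' E).Countable :=
        (hc y).mono (by
          intro x hx
          have hx : (y, x) ∈ E := hx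
          exact ⟨hx.2.2, hx.2.1⟩)
      have := (measure_biUnion_null_iff (μ := κ y) (s := fun x : X => ({x} : Set X)) hcy).2
        (fun x hx => hx.1)
      rwa [biUnion_of_singleton] at this
    have h1 : ν ((fun x => (s x, x)) ⁻¹' E) = 0 := by
      rw [← Measure.map_apply hsx hE]; exact hρE
    have hmE : MeasurableSet {x | κ (s x) {x} = 0} :=
      (hmeas.comp hsx) (measurableSet_singleton 0)
    rw [Measure.restrict_apply hmE]
    rw [Measure.restrict_apply (hsx hE)] at h1
    refine measure_mono_null ?_ h1
    rintro x ⟨hx, hxB⟩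
    exact ⟨⟨hx, rfl, hxB⟩, hxB⟩
  let b := TopologicalSpace.countableBasis X
  let F : Set X → Set X := fun U => (B ∩ U) ∩ {x | κ (s x) U < 2 * κ (s x) {x}}
  have hFm : ∀ U ∈ b, MeasurableSet (F U) := by
    intro U hU
    have hUm : MeasurableSet U := (TopologicalSpace.isOpen_of_mem_countableBasis hU).measurableSet
    refine (hB.inter hUm).inter ?_
    exact measurableSet_lt ((κ.measurable_coe hUm).comp hs) ((hmeas.comp hsx).const_mul 2)
  have hinj : ∀ U ∈ b, InjOn s (F U) := by
    intro U hU x hx x' hx' hxx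
    by_contra hne
    have h1 : κ (s x) U < 2 * κ (s x) {x} := hx.2
    have h2 : κ (s x') U < 2 * κ (s x') {x'} := hx'.2
    rw [← hxx] at h2
    have h3 : κ (s x) {x} + κ (s x) {x'} ≤ κ (s x) U := by
      rw [← measure_union (by simpa using hne) (measurableSet_singleton _)]
      apply measure_mono
      rintro z (hz | hz)
      · rw [mem_singleton_iff.1 hz]; exact hx.1.2
      · rw [mem_singleton_iff.1 hz]; exact hx'.1.2
    have h4 := ENNReal.add_lt_add h1 h2
    rw [← mul_add, ← two_mul] at h4
    have h5 : 2 * (κ (s x) {x} + κ (s x) {x'}) ≤ 2 * κ (s x) U := by gcongr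
    exact absurd h4 (not_lt.2 h5)
  by_contra hcon
  push Not at hcon
  have hF0 : ∀ U ∈ b, μ (F U) = 0 := by
    intro U hU
    by_contra h
    exact hcon (F U) (fun x hx => hx.1.1) (hFm U hU) h (hinj U hU)
  have hU0 : μ (⋃ U ∈ b, F U) = 0 :=
    (measure_biUnion_null_iff (TopologicalSpace.countable_countableBasis X)).2 hF0
  have hN : μ (B ∩ {x | κ (s x) {x} = 0}) = 0 := by
    have hmE : MeasurableSet {x | κ (s x) {x} = 0} :=
      (hmeas.comp hsx) (measurableSet_singleton 0)
    rw [Measure.restrict_apply hmE] at hnull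
    rwa [inter_comm]
  apply h0
  refine measure_mono_null ?_ (measure_union_null hU0 hN)
  intro x hx
  by_cases hk : κ (s x) {x} = 0
  · exact Or.inr ⟨hx, hk⟩
  · left
    have hlt : κ (s x) {x} < 2 * κ (s x) {x} := by
      rw [two_mul]
      exact ENNReal.lt_add_right (measure_ne_top _ _) hk
    obtain ⟨V, hV, hVo, hVlt⟩ := Set.exists_isOpen_lt_of_lt {x} _ hlt
    obtain ⟨U, hU, hxU, hUV⟩ := (TopologicalSpace.isBasis_countableBasis X).exists_subset_of_mem_open
      (singleton_subset_iff.1 hV) hVo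
    simp only [mem_iUnion]
    exact ⟨U, hU, ⟨hx, hxU⟩, (measure_mono hUV).trans_lt hVlt⟩

open Set in
theorem ERS_swap {X : Type*} [MeasurableSpace X] [StandardBorelSpace X] (F : Set X)
    (hF : MeasurableSet F) (s : X → X) (hs : Measurable s) (hi : InjOn s F)
    (hd : Disjoint F (s '' F)) :
    ∃ f : X ≃ᵐ X, (∀ x ∈ F, f x = s x) ∧ (∀ x ∈ F, f (s x) = x) ∧
      ∀ x, x ∉ F → x ∉ s '' F → f x = x := by
  classical
  have hinv : ∀ y : X, ∃ x, y ∈ s '' F → x ∈ F ∧ s x = y := by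
    intro y
    by_cases h : y ∈ s '' F
    · obtain ⟨x, hx, hxy⟩ := h; exact ⟨x, fun _ => ⟨hx, hxy⟩⟩
    · exact ⟨y, fun h' => absurd h' h⟩
  choose t ht using hinv
  let f : X → X := fun x => if x ∈ F then s x else if x ∈ s '' F then t x else x
  have h1 : ∀ x ∈ F, f x = s x := fun x hx => by simp only [f, hx, if_true]
  have hnot : ∀ x ∈ F, s x ∉ F := fun x hx h => disjoint_left.1 hd h ⟨x, hx, rfl⟩
  have h2 : ∀ x ∈ F, f (s x) = x := fun x hx => by
    have hm : s x ∈ s '' F := ⟨x, hx, rfl⟩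
    simp only [f, hnot x hx, hm, if_true, if_false]
    exact hi (ht _ hm).1 hx (ht _ hm).2
  have h3 : ∀ x, x ∉ F → x ∉ s '' F → f x = x := fun x hx hx' => by
    simp only [f, hx, hx', if_false]
  have hff : ∀ x, f (f x) = x := by
    intro x
    by_cases hx : x ∈ F
    · rw [h1 x hx, h2 x hx]
    · by_cases hx' : x ∈ s '' F
      · obtain ⟨z, hz, rfl⟩ := hx'
        rw [h2 z hz, h1 z hz]
      · rw [h3 x hx hx', h3 x hx hx']
  have hsF : MeasurableSet (s '' F) := hF.image_of_measurable_injOn hs hi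
  have hfm : Measurable f := by
    intro A hA
    have : f ⁻¹' A = (F ∩ s ⁻¹' A) ∪ (s '' (F ∩ A)) ∪ ((A \ F) \ (s '' F)) := by
      ext x
      by_cases hx : x ∈ F
      · have hn : x ∉ s '' F := disjoint_left.1 hd hx
        have hn' : x ∉ s '' (F ∩ A) := fun h => hn (image_mono inter_subset_left h)
        simp only [mem_preimage, h1 x hx, mem_union, mem_inter_iff, hx, hn', Set.mem_sdiff]
        tauto
      · by_cases hx' : x ∈ s '' F
        · have : x ∈ s '' (F ∩ A) ↔ f x ∈ A := by
            obtain ⟨z, hz, rfl⟩ := hx'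
            rw [h2 z hz]
            constructor
            · rintro ⟨w, ⟨hw, hwA⟩, hwz⟩
              rwa [← hi hw hz hwz]
            · intro h; exact ⟨z, ⟨hz, h⟩, rfl⟩
          simp only [mem_preimage, mem_union, mem_inter_iff, hx, hx', this, Set.mem_sdiff]
          tauto
        · have hn' : x ∉ s '' (F ∩ A) := fun h => hx' (image_mono inter_subset_left h)
          simp only [mem_preimage, h3 x hx hx', mem_union, mem_inter_iff, hx, hx', hn', Set.mem_sdiff]
          tauto
    rw [this]
    exact ((hF.inter (hs hA)).union ((hF.inter hA).image_of_measurable_injOn hs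
      (hi.mono inter_subset_left))).union ((hA.diff hF).diff hsF)
  exact ⟨⟨⟨f, f, hff, hff⟩, hfm, hfm⟩, h1, h2, h3⟩

open Set in
theorem ERS_invariant {X : Type*} [TopologicalSpace X] [PolishSpace X] [MeasurableSpace X]
    [BorelSpace X] (S : Set (X × X)) (hS : MeasurableSet S)
    (hsymm : ∀ ⦃x y⦄, (x, y) ∈ S → (y, x) ∈ S)
    (A B : Set X) (hA : AnalyticSet A) (hB : AnalyticSet B) (hAB : Disjoint A B)
    (hBinv : ∀ x ∈ B, ∀ y, (x, y) ∈ S → y ∈ B) :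
    ∃ C, MeasurableSet C ∧ A ⊆ C ∧ Disjoint B C ∧ ∀ x ∈ C, ∀ y, (x, y) ∈ S → y ∈ C := by
  obtain ⟨C₀, hAC, hBC, hC⟩ := hA.measurablySeparable hB hAB
  have step : ∀ C : {C : Set X // MeasurableSet C ∧ Disjoint B C},
      ∃ D : {C : Set X // MeasurableSet C ∧ Disjoint B C},
        ∀ x ∈ C.1, ∀ y, (x, y) ∈ S → y ∈ D.1 := by
    rintro ⟨C, hC, hBC⟩
    have han : AnalyticSet (Prod.snd '' (S ∩ Prod.fst ⁻¹' C)) :=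
      (hS.inter (measurable_fst hC)).analyticSet_image measurable_snd
    have hdis : Disjoint (Prod.snd '' (S ∩ Prod.fst ⁻¹' C)) B := by
      rw [disjoint_left]
      rintro _ ⟨⟨x, y⟩, ⟨hxy, hx⟩, rfl⟩ hy
      exact disjoint_left.1 hBC (hBinv y hy x (hsymm hxy)) hx
    obtain ⟨D, h1, h2, h3⟩ := han.measurablySeparable hB hdis
    exact ⟨⟨D, h3, h2⟩, fun x hx y hxy => h1 ⟨(x, y), ⟨hxy, hx⟩, rfl⟩⟩
  choose next hnext using step
  let C : ℕ → {C : Set X // MeasurableSet C ∧ Disjoint B C} :=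
    fun n => Nat.rec ⟨C₀, hC, hBC⟩ (fun _ D => next D) n
  refine ⟨⋃ n, (C n).1, MeasurableSet.iUnion fun n => (C n).2.1,
    hAC.trans (subset_iUnion (fun n => (C n).1) 0), ?_, ?_⟩
  · rw [disjoint_iUnion_right]
    exact fun n => (C n).2.2
  · intro x hx y hxy
    obtain ⟨n, hn⟩ := mem_iUnion.1 hx
    exact mem_iUnion.2 ⟨n + 1, hnext (C n) x hn y hxy⟩

open Set in
theorem ERS_main
    {X : Type} [MeasurableSpace X] [StandardBorelSpace X]
    (μ : Measure X) [IsProbabilityMeasure μ]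
    (R : Set (X × X)) (hRmeas : MeasurableSet R)
    (hrefl : ∀ x, (x, x) ∈ R)
    (hsymm : ∀ ⦃x y⦄, (x, y) ∈ R → (y, x) ∈ R)
    (htrans : ∀ ⦃x y z⦄, (x, y) ∈ R → (y, z) ∈ R → (x, z) ∈ R)
    (hcount : ∀ x, {y | (x, y) ∈ R}.Countable)
    (hqi : IsQuasiInvariant μ R)
    (Γ : Type) [Group Γ] [Countable Γ] (c : X → X → Γ)
    (hcmeas : ∀ g : Γ, MeasurableSet {p : X × X | p ∈ R ∧ c p.1 p.2 = g})
    (hcocycle : ∀ x y z, (x, y) ∈ R → (y, z) ∈ R → c x z = c x y * c y z)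
    (hker : IsErgodicRel μ {p | p ∈ R ∧ c p.1 p.2 = 1}) :
    ∃ Λ : Subgroup Γ, ∀ᵐ x ∂μ,
      {g : Γ | ∃ y, (x, y) ∈ R ∧ c x y = g} = (Λ : Set Γ) := by
  let := upgradeStandardBorel X
  have hbor : BorelSpace X := ⟨eq_borel_upgradeStandardBorel X⟩
  have hc1 : ∀ x, c x x = 1 := by
    intro x
    have := hcocycle x x x (hrefl x) (hrefl x)
    exact (left_eq_mul.1 this)
  have hcinv : ∀ x y, (x, y) ∈ R → c y x = (c x y)⁻¹ := by
    intro x y h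
    have := hcocycle x y x h (hsymm h)
    rw [hc1] at this
    exact eq_inv_of_mul_eq_one_right this.symm
  let S : Set (X × X) := {p | p ∈ R ∧ c p.1 p.2 = 1}
  have hS : MeasurableSet S := hcmeas 1
  have hSsymm : ∀ ⦃x y⦄, (x, y) ∈ S → (y, x) ∈ S := by
    rintro x y ⟨h1, h2⟩
    refine ⟨hsymm h1, ?_⟩
    change c y x = 1
    rw [hcinv x y h1]; change c x y = 1 at h2; rw [h2, inv_one]
  let P : Γ → Set (X × X) := fun g => {p | p ∈ R ∧ c p.1 p.2 = g}
  let A : Γ → Set X := fun g => Prod.fst '' P g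
  have hAmem : ∀ g x, x ∈ A g ↔ ∃ y, (x, y) ∈ R ∧ c x y = g := by
    intro g x
    constructor
    · rintro ⟨⟨x, y⟩, ⟨h1, h2⟩, rfl⟩; exact ⟨y, h1, h2⟩
    · rintro ⟨y, h1, h2⟩; exact ⟨(x, y), ⟨h1, h2⟩, rfl⟩
  have hAan : ∀ g, AnalyticSet (A g) := fun g => (hcmeas g).analyticSet_image measurable_fst
  have hAinv : ∀ g, ∀ x ∈ A g, ∀ y, (x, y) ∈ S → y ∈ A g := by
    intro g x hx y hxy
    obtain ⟨z, hz, hg⟩ := (hAmem g x).1 hx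
    refine (hAmem g y).2 ⟨z, htrans (hsymm hxy.1) hz, ?_⟩
    rw [hcocycle y x z (hsymm hxy.1) hz, hg, show c y x = 1 from (hSsymm hxy).2, one_mul]
  -- zero-one law
  have h01 : ∀ g, μ (A g) = 0 ∨ μ (A g)ᶜ = 0 := by
    intro g
    obtain ⟨B, hB, hBA, hB0⟩ := ERS_nullMeasurable μ (A g) (hAan g)
    -- a Borel subset of the complement of full measure
    let N := toMeasurable μ (A g \ B)
    have hN : MeasurableSet N := measurableSet_toMeasurable _ _
    have hN0 : μ N = 0 := by rw [measure_toMeasurable]; exact hB0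
    have hAN : A g ⊆ B ∪ N := fun x hx => by
      by_cases hxB : x ∈ B
      · exact Or.inl hxB
      · exact Or.inr (subset_toMeasurable μ _ ⟨hx, hxB⟩)
    let D := (B ∪ N)ᶜ
    have hD : MeasurableSet D := (hB.union hN).compl
    have hEan : AnalyticSet (D ∪ Prod.snd '' (S ∩ Prod.fst ⁻¹' D)) := by
      rw [union_eq_iUnion]
      refine AnalyticSet.iUnion fun b => ?_
      cases b
      · exact (hS.inter (measurable_fst hD)).analyticSet_image measurable_snd
      · exact hD.analyticSet
    have hmul : ∀ ⦃x y z⦄, (x, y) ∈ S → (y, z) ∈ S → (x, z) ∈ S := by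
      rintro x y z ⟨h1, h2⟩ ⟨h3, h4⟩
      refine ⟨htrans h1 h3, ?_⟩
      change c x y = 1 at h2
      change c y z = 1 at h4
      change c x z = 1
      rw [hcocycle x y z h1 h3, h2, h4, one_mul]
    obtain ⟨C, hC, hAC, hEC, hCinv⟩ := ERS_invariant S hS hSsymm (A g)
      (D ∪ Prod.snd '' (S ∩ Prod.fst ⁻¹' D)) (hAan g) hEan (by
        rw [disjoint_left]
        rintro x hx (hxD | ⟨⟨y, x⟩, ⟨hyx, hy⟩, rfl⟩)
        · exact hxD (hAN hx)
        · exact hy (hAN (hAinv g x hx y (hSsymm hyx)))) (by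
        rintro x (hxD | ⟨⟨y, x⟩, ⟨hyx, hy⟩, rfl⟩) z hxz
        · exact Or.inr ⟨(x, z), ⟨hxz, hxD⟩, rfl⟩
        · exact Or.inr ⟨(y, z), ⟨hmul hyx hxz, hy⟩, rfl⟩)
    rcases hker C hC hCinv with h | h
    · left; exact measure_mono_null hAC h
    · right
      have hCc : μ Cᶜ = 0 := (prob_compl_eq_zero_iff hC).2 h
      refine measure_mono_null ?_ (measure_union_null hCc hN0)
      intro x hx
      by_cases hxC : x ∈ C
      · right
        by_contra hxN
        refine disjoint_left.1 hEC (Or.inl ?_) hxC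
        rintro (h | h)
        · exact hx (hBA h)
        · exact hxN h
      · exact Or.inl hxC
  let L : Set Γ := {g | μ (A g)ᶜ = 0}
  have hgood : ∀ᵐ x ∂μ, ∀ g, x ∈ A g ↔ g ∈ L := by
    rw [ae_all_iff]
    intro g
    by_cases hg : g ∈ L
    · have : ∀ᵐ x ∂μ, x ∈ A g := mem_ae_iff.2 hg
      filter_upwards [this] with x hx
      simp [hx, hg]
    · have h0 : μ (A g) = 0 := (h01 g).resolve_right hg
      have : ∀ᵐ x ∂μ, x ∉ A g := measure_eq_zero_iff_ae_notMem.1 h0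
      filter_upwards [this] with x hx
      simp [hx, hg]
  let N := toMeasurable μ {x | ∀ g, x ∈ A g ↔ g ∈ L}ᶜ
  have hN : MeasurableSet N := measurableSet_toMeasurable _ _
  have hN0 : μ N = 0 := by rw [measure_toMeasurable]; exact hgood
  have hNg : ∀ x, x ∉ N → ∀ g, x ∈ A g ↔ g ∈ L := by
    intro x hx
    by_contra h
    exact hx (subset_toMeasurable μ _ h)
  have hkey : ∀ g ∈ L, ∃ x y, x ∉ N ∧ y ∉ N ∧ (x, y) ∈ R ∧ c x y = g := by
    intro g hg
    by_contra hcon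
    push Not at hcon
    let Q : Set (X × X) := P g ∩ Prod.fst ⁻¹' Nᶜ
    have hQ : MeasurableSet Q := (hcmeas g).inter (measurable_fst hN.compl)
    have hQN : ∀ x y, (x, y) ∈ Q → y ∈ N := by
      rintro x y ⟨⟨h1, h2⟩, h3⟩
      by_contra hy
      exact hcon x y h3 hy h1 h2
    have hfst : μ (Prod.fst '' Q) ≠ 0 := by
      intro h
      have h1 : μ ((Prod.fst '' Q) ∪ ((A g)ᶜ ∪ N)) = 0 :=
        measure_union_null h (measure_union_null hg hN0)
      have h2 : (Prod.fst '' Q) ∪ ((A g)ᶜ ∪ N) = univ := by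
        rw [eq_univ_iff_forall]
        intro x
        by_cases hx : x ∈ A g
        · by_cases hxN : x ∈ N
          · exact Or.inr (Or.inr hxN)
          · obtain ⟨y, h1, h2⟩ := (hAmem g x).1 hx
            exact Or.inl ⟨(x, y), ⟨⟨h1, h2⟩, hxN⟩, rfl⟩
        · exact Or.inr (Or.inl hx)
      rw [h2, measure_univ] at h1
      exact one_ne_zero h1
    have hQa : AnalyticSet Q := hQ.analyticSet
    rw [AnalyticSet] at hQa
    rcases hQa with hQe | ⟨F, hF, hFQ⟩
    · rw [hQe] at hfst; simp at hfst
    · have hr : range (fun a => (F a).1) = Prod.fst '' Q := by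
        rw [← hFQ, ← range_comp]; rfl
      obtain ⟨B, σ, hB, hB0, hσ, hBσ⟩ := ERS_section μ (fun a => (F a).1)
        (continuous_fst.comp hF) (by rw [hr]; exact hfst)
      let s : X → X := fun x => (F (σ x)).2
      have hs : Measurable s := (continuous_snd.comp hF).measurable.comp hσ
      have hBs : ∀ x ∈ B, (x, s x) ∈ Q := by
        intro x hx
        have h1 : F (σ x) ∈ Q := by rw [← hFQ]; exact ⟨_, rfl⟩
        have h2 : (x, s x) = F (σ x) := Prod.ext (hBσ x hx).symm rfl
        rw [h2]; exact h1
      obtain ⟨E, hEB, hE, hE0, hinj⟩ := ERS_injOn μ B hB hB0 s hs (by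
        intro y
        refine (hcount y).mono ?_
        rintro x ⟨hx, hxy⟩
        have h := (hBs x hx).1.1
        rw [mem_singleton_iff.1 hxy] at h
        exact hsymm h)
      have hsE : s '' E ⊆ N := by
        rintro _ ⟨x, hx, rfl⟩
        exact hQN x _ (hBs x (hEB hx))
      have hdis : Disjoint E (s '' E) := by
        rw [disjoint_left]
        intro x hx hx'
        exact (hBs x (hEB hx)).2 (hsE hx')
      obtain ⟨f, hf1, hf2, hf3⟩ := ERS_swap E hE s hs hinj hdis
      have hfR : ∀ x, (x, f x) ∈ R := by
        intro x
        by_cases hx : x ∈ E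
        · rw [hf1 x hx]; exact (hBs x (hEB hx)).1.1
        · by_cases hx' : x ∈ s '' E
          · obtain ⟨z, hz, rfl⟩ := hx'
            rw [hf2 z hz]; exact hsymm (hBs z (hEB hz)).1.1
          · rw [hf3 x hx hx']; exact hrefl x
      have h0 := (hqi f hfR N hN).1 hN0
      refine hE0 (measure_mono_null ?_ h0)
      intro x hx
      change f x ∈ N
      rw [hf1 x hx]
      exact hsE ⟨x, hx, rfl⟩
  have htransl : ∀ g ∈ L, ∀ h, g * h ∈ L ↔ h ∈ L := by
    intro g hg h
    obtain ⟨x, y, hx, hy, hxy, rfl⟩ := hkey g hg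
    rw [← hNg x hx, ← hNg y hy, hAmem, hAmem]
    constructor
    · rintro ⟨z, hz, hzc⟩
      refine ⟨z, htrans (hsymm hxy) hz, ?_⟩
      rw [hcocycle y x z (hsymm hxy) hz, hzc, hcinv x y hxy, inv_mul_cancel_left]
    · rintro ⟨z, hz, hzc⟩
      exact ⟨z, htrans hxy hz, by rw [hcocycle x y z hxy hz, hzc]⟩
  have hone : (1 : Γ) ∈ L := by
    change μ (A 1)ᶜ = 0
    have : A 1 = univ := eq_univ_of_forall fun x => (hAmem 1 x).2 ⟨x, hrefl x, hc1 x⟩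
    rw [this]; simp
  refine ⟨{ carrier := L, mul_mem' := fun {a b} ha hb => (htransl a ha b).2 hb, one_mem' := hone,
            inv_mem' := fun {a} ha => (htransl a ha a⁻¹).1 (by rw [mul_inv_cancel]; exact hone) }, ?_⟩
  filter_upwards [hgood] with x hx
  ext g
  exact (hAmem g x).symm.trans (hx g)

/-- if `c : R → Γ` is a cocycle into a countable group `Γ` whose
kernel is ergodic w.r.t. an `R`-quasi-invariant probability measure `μ`, then
the sets `Γ_x = {c(x,y) : y ∈ [x]_R}` coincide with (the carrier of) a fixed
subgroup `Λ ≤ Γ` for `μ`-a.e. `x`. -/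
theorem essential_range_is_subgroup
    {X : Type} [MeasurableSpace X] [StandardBorelSpace X]
    (μ : Measure X) [IsProbabilityMeasure μ]
    (R : Set (X × X)) (hRmeas : MeasurableSet R)
    (hrefl : ∀ x, (x, x) ∈ R)
    (hsymm : ∀ ⦃x y⦄, (x, y) ∈ R → (y, x) ∈ R)
    (htrans : ∀ ⦃x y z⦄, (x, y) ∈ R → (y, z) ∈ R → (x, z) ∈ R)
    (hcount : ∀ x, {y | (x, y) ∈ R}.Countable)
    (hqi : IsQuasiInvariant μ R)
    (Γ : Type) [Group Γ] [Countable Γ] (c : X → X → Γ)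
    (hcmeas : ∀ g : Γ, MeasurableSet {p : X × X | p ∈ R ∧ c p.1 p.2 = g})
    (hcocycle : ∀ x y z, (x, y) ∈ R → (y, z) ∈ R → c x z = c x y * c y z)
    (hker : IsErgodicRel μ {p | p ∈ R ∧ c p.1 p.2 = 1}) :
    ∃ Λ : Subgroup Γ, ∀ᵐ x ∂μ,
      {g : Γ | ∃ y, (x, y) ∈ R ∧ c x y = g} = (Λ : Set Γ) := by
  exact ERS_main μ R hRmeas hrefl hsymm htrans hcount hqi Γ c hcmeas hcocycle hker
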